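/- Let N = 6, m ≥ 2, and let (λ̄, u^{m−1}), v̄₀ and the family of solutions u_ε = ū^{m−1} + ε·v̄₀ − PU_{δ_ε} + φ_ε constructed in the Ljapunov–Schmidt existence theorem be as in the context (with δ_ε/|ε| → d = (8√3/11)·|1 − 2v̄₀(0)|/λ̄^{3/2} and ‖φ_ε‖_{H¹₀(B)} = O(ε²|ln|ε||^{2/3})). Then ‖u_ε‖_∞ = −u_ε(0) and ε²·‖u_ε‖_∞ → (121/8)·λ̄³/(1 − 2v̄₀(0))² as ε → 0. -/

import Mathlib

open Real Set Filter Topology intervalIntegral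


/-- `(lamBar, w)` solves the overdetermined radial problem in dimension `6`:
`w'' + (5/r)w' + |w|w + lamBar·w = 0` on `(0,1)`, `w'(0) = 0`, `w(1) = 0`,
`w(0) = -lamBar/2`, and `w` has exactly `m - 1` nodal zones (`m - 2` zeros in `(0,1)`). -/
structure OverdetSol (lamBar : ℝ) (m : ℕ) (w w' w'' : ℝ → ℝ) : Prop where
  lam_pos : 0 < lamBar
  deriv_fst : ∀ r ∈ Set.Icc (0:ℝ) 1, HasDerivWithinAt w (w' r) (Set.Icc (0:ℝ) 1) r
  deriv_snd : ∀ r ∈ Set.Icc (0:ℝ) 1, HasDerivWithinAt w' (w'' r) (Set.Icc (0:ℝ) 1) r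
  ode : ∀ r ∈ Set.Ioo (0:ℝ) 1, w'' r + (5 / r) * w' r + |w r| * w r + lamBar * w r = 0
  bc_deriv_zero : w' 0 = 0
  bc_one : w 1 = 0
  val_zero : w 0 = -lamBar / 2
  nodal : {r : ℝ | r ∈ Set.Ioo (0:ℝ) 1 ∧ w r = 0}.ncard = m - 2

/-- Nondegeneracy of a solution `w` of the overdetermined problem: the only radial
solution of the linearized equation with Dirichlet boundary conditions is the trivial one. -/
def Nondeg (lamBar : ℝ) (w : ℝ → ℝ) : Prop :=
  ∀ v v' v'' : ℝ → ℝ,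
    (∀ r ∈ Set.Icc (0:ℝ) 1, HasDerivWithinAt v (v' r) (Set.Icc (0:ℝ) 1) r) →
    (∀ r ∈ Set.Icc (0:ℝ) 1, HasDerivWithinAt v' (v'' r) (Set.Icc (0:ℝ) 1) r) →
    (∀ r ∈ Set.Ioo (0:ℝ) 1, v'' r + (5 / r) * v' r + (2 * |w r| + lamBar) * v r = 0) →
    v' 0 = 0 → v 1 = 0 → ∀ r ∈ Set.Icc (0:ℝ) 1, v r = 0

/-- Radial profile of the standard bubble `U_δ` in dimension `6`. -/
noncomputable def Urad (δ r : ℝ) : ℝ := 24 * δ ^ 2 / (δ ^ 2 + r ^ 2) ^ 2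

/-- Radial profile of the projection `PU_δ` of the standard bubble onto `H¹₀(B)`,
`B` the unit ball of `ℝ⁶`: `-Δ PU_δ = U_δ²` in `B`, `PU_δ = 0` on `∂B`. -/
noncomputable def PUrad (δ r : ℝ) : ℝ :=
  24 * δ ^ 2 * (1 / (δ ^ 2 + r ^ 2) ^ 2 - 1 / (δ ^ 2 + 1) ^ 2)

/-- A radial nodal solution of the Brezis–Nirenberg problem `-Δu = |u|u + λu` on the
unit ball of `ℝ⁶` with `m` nodal zones (no condition on the sign at the origin). -/
structure BN6NodalSol (lam : ℝ) (m : ℕ) (u u' u'' : ℝ → ℝ) : Prop where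
  deriv_fst : ∀ r ∈ Set.Icc (0:ℝ) 1, HasDerivWithinAt u (u' r) (Set.Icc (0:ℝ) 1) r
  deriv_snd : ∀ r ∈ Set.Icc (0:ℝ) 1, HasDerivWithinAt u' (u'' r) (Set.Icc (0:ℝ) 1) r
  ode : ∀ r ∈ Set.Ioo (0:ℝ) 1, u'' r + (5 / r) * u' r + |u r| * u r + lam * u r = 0
  bc_deriv_zero : u' 0 = 0
  bc_one : u 1 = 0
  nodal : {r : ℝ | r ∈ Set.Ioo (0:ℝ) 1 ∧ u r = 0}.ncard = m - 1

lemma aux_abs_cube (x : ℝ) : HasDerivAt (fun x : ℝ => |x| * x ^ 2) (3 * |x| * x) x := by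
  rcases lt_trichotomy x 0 with h | h | h
  · have h1 : HasDerivAt (fun x : ℝ => -x ^ 3) (-(3 * x ^ 2)) x := by
      exact (hasDerivAt_pow 3 x).neg.congr_deriv (by simp)
    have h2 : (fun x : ℝ => |x| * x ^ 2) =ᶠ[𝓝 x] (fun x : ℝ => -x ^ 3) := by
      filter_upwards [Iio_mem_nhds h] with y hy
      rw [abs_of_neg hy]; ring
    refine (h1.congr_of_eventuallyEq h2).congr_deriv ?_
    rw [abs_of_neg h]; ring
  · subst h
    rw [hasDerivAt_iff_tendsto_slope_zero]
    have : Tendsto (fun t : ℝ => |t| * t) (𝓝[≠] 0) (𝓝 0) := by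
      have hc : Continuous (fun t : ℝ => |t| * t) := by fun_prop
      have := hc.tendsto 0
      simp only [abs_zero, zero_mul] at this
      exact this.mono_left nhdsWithin_le_nhds
    simp only [abs_zero, mul_zero]
    refine this.congr' ?_
    filter_upwards [self_mem_nhdsWithin] with t ht
    have ht : t ≠ 0 := ht
    simp only [zero_add, smul_eq_mul]
    field_simp
    simp
  · have h1 : HasDerivAt (fun x : ℝ => x ^ 3) (3 * x ^ 2) x := by
      simpa using (hasDerivAt_pow 3 x)
    have h2 : (fun x : ℝ => |x| * x ^ 2) =ᶠ[𝓝 x] (fun x : ℝ => x ^ 3) := by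
      filter_upwards [Ioi_mem_nhds h] with y hy
      rw [abs_of_pos hy]; ring
    refine (h1.congr_of_eventuallyEq h2).congr_deriv ?_
    rw [abs_of_pos h]; ring

/-- antitone from derivative sign on the open interval. -/
lemma aux_anti {f f' : ℝ → ℝ} (hc : ContinuousOn f (Icc 0 1))
    (hd : ∀ r ∈ Ioo (0:ℝ) 1, HasDerivAt f (f' r) r) (hs : ∀ r ∈ Ioo (0:ℝ) 1, f' r ≤ 0)
    {r : ℝ} (hr : r ∈ Icc (0:ℝ) 1) : f r ≤ f 0 := by
  have : AntitoneOn f (Icc 0 1) := by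
    apply antitoneOn_of_deriv_nonpos (convex_Icc 0 1) hc
    · rw [interior_Icc]; intro x hx; exact (hd x hx).differentiableAt.differentiableWithinAt
    · rw [interior_Icc]; intro x hx; rw [(hd x hx).deriv]; exact hs x hx
  exact this (by simp) hr hr.1

lemma aux_at {f : ℝ → ℝ} {f' r : ℝ} (hr : r ∈ Ioo (0:ℝ) 1)
    (h : HasDerivWithinAt f f' (Icc (0:ℝ) 1) r) : HasDerivAt f f' r :=
  h.hasDerivAt (Icc_mem_nhds hr.1 hr.2)

lemma aux_max {lam : ℝ} {m : ℕ} {u u' u'' : ℝ → ℝ} (hl : 0 < lam)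
    (h : BN6NodalSol lam m u u' u'') {r : ℝ} (hr : r ∈ Icc (0:ℝ) 1) : |u r| ≤ |u 0| := by
  have cu : ContinuousOn u (Icc 0 1) := fun r hr => (h.deriv_fst r hr).continuousWithinAt
  have cu' : ContinuousOn u' (Icc 0 1) := fun r hr => (h.deriv_snd r hr).continuousWithinAt
  have key := aux_anti (f := fun r => u' r ^ 2 / 2 + |u r| * u r ^ 2 / 3 + lam * u r ^ 2 / 2)
    (f' := fun r => u' r * u'' r + |u r| * u r * u' r + lam * u r * u' r)
    (by fun_prop) (by
      intro r hr
      have d1 := aux_at hr (h.deriv_fst r (Ioo_subset_Icc_self hr))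
      have d2 := aux_at hr (h.deriv_snd r (Ioo_subset_Icc_self hr))
      have d3 := (aux_abs_cube (u r)).comp r d1
      have := (((d2.pow 2).div_const 2).add (d3.div_const 3)).add
        (((d1.pow 2).const_mul lam).div_const 2)
      refine this.congr_deriv ?_
      push_cast; ring) (by
      intro r hr
      have o := h.ode r hr
      have : u' r * u'' r + |u r| * u r * u' r + lam * u r * u' r = -((5 / r) * u' r ^ 2) := by
        linear_combination (u' r) * o
      rw [this]
      have := hr.1
      simp only [Left.neg_nonpos_iff]; positivity) hr
  simp only [h.bc_deriv_zero] at key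
  by_contra hlt
  push Not at hlt
  have h2 : u 0 ^ 2 < u r ^ 2 := sq_lt_sq.mpr hlt
  have h3 : |u 0| * u 0 ^ 2 ≤ |u r| * u r ^ 2 := by gcongr
  nlinarith [sq_nonneg (u' r)]

lemma aux_taylor {lam : ℝ} {m : ℕ} {u u' u'' : ℝ → ℝ} (hl : 0 < lam)
    (h : BN6NodalSol lam m u u' u'') {r : ℝ} (hr : r ∈ Icc (0:ℝ) 1) :
    |u r - u 0| ≤ |u 0| * (|u 0| + lam) * r ^ 2 / 12 := by
  have cu : ContinuousOn u (Icc 0 1) := fun r hr => (h.deriv_fst r hr).continuousWithinAt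
  have cu' : ContinuousOn u' (Icc 0 1) := fun r hr => (h.deriv_snd r hr).continuousWithinAt
  set M := |u 0| * (|u 0| + lam) with hM
  have hf : ∀ r ∈ Icc (0:ℝ) 1, |(|u r| * u r + lam * u r)| ≤ M := by
    intro r hr
    have := aux_max hl h hr
    have e : |u r| * u r + lam * u r = (|u r| + lam) * u r := by ring
    rw [e, abs_mul, abs_of_nonneg (by positivity), hM, mul_comm]
    gcongr
  have dd : ∀ r ∈ Ioo (0:ℝ) 1, HasDerivAt (fun r => r ^ 5 * u' r)
      (-(r ^ 5 * (|u r| * u r + lam * u r))) r := by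
    intro r hr
    have d2 := aux_at hr (h.deriv_snd r (Ioo_subset_Icc_self hr))
    have o := h.ode r hr
    have := (hasDerivAt_pow 5 r).mul d2
    refine this.congr_deriv ?_
    have hr0 : r ≠ 0 := hr.1.ne'
    have o' : u'' r = -(5 / r * u' r) - |u r| * u r - lam * u r := by linarith
    rw [o']
    field_simp
    push_cast
    ring
  have d6 : ∀ r : ℝ, HasDerivAt (fun r : ℝ => M * r ^ 6 / 6) (M * r ^ 5) r := by
    intro r
    have := ((hasDerivAt_pow 6 r).const_mul M).div_const 6
    refine this.congr_deriv ?_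
    push_cast; ring
  have d2' : ∀ r : ℝ, HasDerivAt (fun r : ℝ => M * r ^ 2 / 12) (M * r / 6) r := by
    intro r
    have := ((hasDerivAt_pow 2 r).const_mul M).div_const 12
    refine this.congr_deriv ?_
    push_cast; ring
  have b1 : ∀ r ∈ Icc (0:ℝ) 1, r ^ 5 * u' r - M * r ^ 6 / 6 ≤ 0 := by
    intro r hr
    have := aux_anti (f := fun r => r ^ 5 * u' r - M * r ^ 6 / 6) (by fun_prop)
      (fun r hr => (dd r hr).sub (d6 r)) (by
        intro r hr
        have := (abs_le.mp (hf r (Ioo_subset_Icc_self hr))).1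
        have := mul_le_mul_of_nonneg_left this (pow_nonneg hr.1.le 5)
        linarith) hr
    simpa using this
  have b2 : ∀ r ∈ Icc (0:ℝ) 1, -(r ^ 5 * u' r) - M * r ^ 6 / 6 ≤ 0 := by
    intro r hr
    have := aux_anti (f := fun r => -(r ^ 5 * u' r) - M * r ^ 6 / 6) (by fun_prop)
      (fun r hr => (dd r hr).neg.sub (d6 r)) (by
        intro r hr
        have := (abs_le.mp (hf r (Ioo_subset_Icc_self hr))).2
        have := mul_le_mul_of_nonneg_left this (pow_nonneg hr.1.le 5)
        linarith) hr
    simpa using this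
  have c1 := aux_anti (f := fun r => u r - M * r ^ 2 / 12) (by fun_prop)
      (fun r hr => (aux_at hr (h.deriv_fst r (Ioo_subset_Icc_self hr))).sub (d2' r)) (by
        intro r hr
        have := b1 r (Ioo_subset_Icc_self hr)
        have h5 : 0 < r ^ 5 := pow_pos hr.1 5
        have : r ^ 5 * (u' r - M * r / 6) ≤ 0 := by linarith
        exact nonpos_of_mul_nonpos_right this h5) hr
  have c2 := aux_anti (f := fun r => -u r - M * r ^ 2 / 12) (by fun_prop)
      (fun r hr => (aux_at hr (h.deriv_fst r (Ioo_subset_Icc_self hr))).neg.sub (d2' r)) (by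
        intro r hr
        have := b2 r (Ioo_subset_Icc_self hr)
        have h5 : 0 < r ^ 5 := pow_pos hr.1 5
        have : r ^ 5 * (-u' r - M * r / 6) ≤ 0 := by linarith
        exact nonpos_of_mul_nonpos_right this h5) hr
  norm_num at c1 c2
  rw [abs_le]
  constructor <;> linarith

/-- Radial lemma. -/
lemma aux_radial {f f' : ℝ → ℝ} (hd : ∀ r ∈ Icc (0:ℝ) 1, HasDerivWithinAt f (f' r) (Icc 0 1) r)
    (hc : ContinuousOn f' (Icc 0 1)) (h1 : f 1 = 0) {κ : ℝ} (hκ : 0 < κ)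
    (hI : ∫ ρ in (0:ℝ)..1, ρ ^ 5 * f' ρ ^ 2 ≤ κ ^ 2) {r : ℝ} (hr0 : 0 < r) (hr1 : r ≤ 1) :
    |f r| ≤ κ / (2 * r ^ 2) := by
  have hsub : Icc r 1 ⊆ Icc (0:ℝ) 1 := Icc_subset_Icc_left hr0.le
  have cf : ContinuousOn f (Icc r 1) := fun x hx => (hd x (hsub hx)).continuousWithinAt.mono hsub
  have hc' : ContinuousOn f' (Icc r 1) := hc.mono hsub
  have ftc : ∫ x in r..1, f' x = f 1 - f r := by
    apply integral_eq_sub_of_hasDerivAt_of_le hr1 cf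
    · intro x hx
      exact aux_at ⟨hr0.trans hx.1, hx.2⟩ (hd x (hsub (Ioo_subset_Icc_self hx)))
    · exact (hc'.mono (by rw [uIcc_of_le hr1])).intervalIntegrable
  have i5 : ∫ x in r..1, (x ^ 5)⁻¹ = (r ^ 4)⁻¹ / 4 - 1 / 4 := by
    have : ∫ x in r..1, (x ^ 5)⁻¹ = -(((1:ℝ) ^ 4)⁻¹ / 4) - -((r ^ 4)⁻¹ / 4) := by
      apply integral_eq_sub_of_hasDerivAt (f := fun x : ℝ => -((x ^ 4)⁻¹ / 4))
      · intro x hx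
        rw [uIcc_of_le hr1] at hx
        have hx0 : x ≠ 0 := (hr0.trans_le hx.1).ne'
        have := (((hasDerivAt_pow 4 x).inv (pow_ne_zero 4 hx0)).div_const 4).neg
        refine this.congr_deriv ?_
        push_cast
        field_simp
      · apply ContinuousOn.intervalIntegrable
        rw [uIcc_of_le hr1]
        apply ContinuousOn.inv₀ (by fun_prop)
        intro x hx
        exact pow_ne_zero 5 (hr0.trans_le hx.1).ne'
    rw [this]; ring
  have cc : ContinuousOn (fun ρ => ρ ^ 5 * f' ρ ^ 2) (Icc 0 1) := by fun_prop
  have ii : IntervalIntegrable (fun ρ => ρ ^ 5 * f' ρ ^ 2) MeasureTheory.volume 0 r := by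
    apply ContinuousOn.intervalIntegrable
    rw [uIcc_of_le hr0.le]; exact cc.mono (Icc_subset_Icc_right hr1)
  have ii2 : IntervalIntegrable (fun ρ => ρ ^ 5 * f' ρ ^ 2) MeasureTheory.volume r 1 := by
    apply ContinuousOn.intervalIntegrable
    rw [uIcc_of_le hr1]; exact cc.mono hsub
  have ii3 : IntervalIntegrable (fun ρ : ℝ => (ρ ^ 5)⁻¹) MeasureTheory.volume r 1 := by
    apply ContinuousOn.intervalIntegrable
    rw [uIcc_of_le hr1]
    apply ContinuousOn.inv₀ (by fun_prop)
    intro x hx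
    exact pow_ne_zero 5 (hr0.trans_le hx.1).ne'
  have hI2 : ∫ ρ in r..1, ρ ^ 5 * f' ρ ^ 2 ≤ κ ^ 2 := by
    rw [← integral_add_adjacent_intervals ii ii2] at hI
    have : 0 ≤ ∫ ρ in (0:ℝ)..r, ρ ^ 5 * f' ρ ^ 2 := by
      apply integral_nonneg hr0.le
      intro x hx
      have := hx.1
      positivity
    linarith
  set t := 1 / (2 * r ^ 2 * κ) with ht
  have htpos : 0 < t := by positivity
  have e1 : |f r| = |∫ x in r..1, f' x| := by rw [ftc, h1]; simp
  have e2 : |∫ x in r..1, f' x| ≤ ∫ x in r..1, (t / 2 * (x ^ 5 * f' x ^ 2) + 1 / (2 * t) * (x ^ 5)⁻¹) := by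
    rw [← Real.norm_eq_abs]
    apply norm_integral_le_of_norm_le hr1
    · refine Filter.Eventually.of_forall ?_
      intro x hx
      have hx0 : 0 < x := hr0.trans hx.1
      rw [Real.norm_eq_abs]
      have h5 : 0 < x ^ 5 := by positivity
      have : t / 2 * (x ^ 5 * f' x ^ 2) + 1 / (2 * t) * (x ^ 5)⁻¹ - |f' x|
          = (t * x ^ 5 * |f' x| - 1) ^ 2 / (2 * t * x ^ 5) := by
        rw [← sq_abs (f' x)]
        field_simp
        ring
      have h0 : 0 ≤ (t * x ^ 5 * |f' x| - 1) ^ 2 / (2 * t * x ^ 5) := by positivity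
      linarith
    · exact (ii2.const_mul _).add (ii3.const_mul _)
  rw [integral_add (ii2.const_mul _) (ii3.const_mul _), integral_const_mul, integral_const_mul, i5] at e2
  rw [e1]
  refine e2.trans ?_
  have g1 : t / 2 * (∫ ρ in r..1, ρ ^ 5 * f' ρ ^ 2) ≤ t / 2 * κ ^ 2 := by gcongr
  have g2 : 1 / (2 * t) * ((r ^ 4)⁻¹ / 4 - 1 / 4) ≤ 1 / (2 * t) * ((r ^ 4)⁻¹ / 4) := by
    gcongr; linarith
  have g3 : t / 2 * κ ^ 2 + 1 / (2 * t) * ((r ^ 4)⁻¹ / 4) = κ / (2 * r ^ 2) := by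
    rw [ht]; field_simp; ring
  linarith

lemma aux_PU_deriv {δ : ℝ} (hδ : 0 < δ) (r : ℝ) :
    HasDerivAt (PUrad δ) (-(96 * δ ^ 2 * r / (δ ^ 2 + r ^ 2) ^ 3)) r := by
  have hp : δ ^ 2 + r ^ 2 ≠ 0 := by positivity
  have h1 : HasDerivAt (fun r : ℝ => δ ^ 2 + r ^ 2) (2 * r) r := by
    simpa using (hasDerivAt_pow 2 r).const_add (δ ^ 2)
  have h2 := ((((h1.pow 2).inv (pow_ne_zero 2 hp)).sub_const (1 / (δ ^ 2 + 1) ^ 2)).const_mul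
    (24 * δ ^ 2))
  have : PUrad δ = fun r => 24 * δ ^ 2 * (((δ ^ 2 + r ^ 2) ^ 2)⁻¹ - 1 / (δ ^ 2 + 1) ^ 2) := by
    funext r; simp [PUrad]
  rw [this]
  refine h2.congr_deriv ?_
  rw [Pi.pow_apply]
  push_cast
  field_simp
  ring

/-- The final one-parameter estimate, purely algebraic. -/
lemma aux_final {δ κ a u0 lam B L : ℝ} {u : ℝ → ℝ} (hδ : 0 < δ) (hδ1 : δ ≤ 1) (hκ : 0 < κ)
    (hκ1 : κ ≤ 1) (ha : a = |u0|) (hl : 0 < lam) (hlL : lam ≤ L) (hB : 0 ≤ B)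
    (h1 : ∀ r, 0 < r → r ≤ 1 → |u r - u0| ≤ a * (a + lam) * r ^ 2 / 12)
    (h2 : ∀ r, 0 < r → r ≤ 1 → |u r + 24 * δ ^ 2 / (δ ^ 2 + r ^ 2) ^ 2| ≤ B + κ / (2 * r ^ 2)) :
    |δ ^ 2 * u0 + 24| ≤ (3 * (24 + B + L + 1)) * (3 * (24 + B + L + 1) + L) * √κ
      + B * δ ^ 2 + 49 * √κ := by
  set A := 3 * (24 + B + L + 1) with hA
  have ha0 : 0 ≤ a := ha ▸ abs_nonneg _
  have hδ2 : δ ^ 2 ≤ 1 := pow_le_one₀ hδ.le hδ1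
  have hδp : 0 < δ ^ 2 := by positivity
  -- step 1
  have s1 : a * δ ^ 2 ≤ A := by
    set q := a + lam + 1 with hq
    have hq1 : 1 ≤ q := by linarith
    have hq0 : 0 < q := by linarith
    have hr2 : (√(1 / q)) ^ 2 = 1 / q := Real.sq_sqrt (by positivity)
    have hr0 : 0 < √(1 / q) := Real.sqrt_pos.mpr (by positivity)
    have hr1 : √(1 / q) ≤ 1 := by
      rw [Real.sqrt_le_one, div_le_one hq0]; exact hq1
    have i1 := h1 _ hr0 hr1
    have i2 := h2 _ hr0 hr1
    rw [hr2] at i1 i2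
    have e1 : a * (a + lam) * (1 / q) / 12 ≤ a / 12 := by
      have : (a + lam) * (1 / q) ≤ 1 := by
        rw [mul_one_div, div_le_one hq0]; linarith
      nlinarith
    have e2 : κ / (2 * (1 / q)) ≤ q / 2 := by
      have : κ / (2 * (1 / q)) = κ * q / 2 := by field_simp
      rw [this]; nlinarith
    have e3 : |24 * δ ^ 2 / (δ ^ 2 + 1 / q) ^ 2| ≤ 24 / δ ^ 2 := by
      rw [abs_of_nonneg (by positivity), div_le_div_iff₀ (by positivity) hδp]
      have : 0 < 1 / q := by positivity
      nlinarith [mul_pos this hδp, mul_pos this this]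
    have e4 : a ≤ |u (√(1 / q)) - u0| + |u (√(1 / q)) + 24 * δ ^ 2 / (δ ^ 2 + 1 / q) ^ 2|
        + |24 * δ ^ 2 / (δ ^ 2 + 1 / q) ^ 2| := by
      rw [ha]
      have x1 := abs_sub_abs_le_abs_sub u0 (u (√(1 / q)))
      rw [abs_sub_comm] at x1
      have x2 := abs_sub (u (√(1 / q)) + 24 * δ ^ 2 / (δ ^ 2 + 1 / q) ^ 2)
        (24 * δ ^ 2 / (δ ^ 2 + 1 / q) ^ 2)
      rw [add_sub_cancel_right] at x2
      linarith
    have e5 : 5 / 12 * a ≤ B + (L + 1) / 2 + 24 / δ ^ 2 := by linarith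
    have e6 : 5 / 12 * a * δ ^ 2 ≤ (B + (L + 1) / 2) * δ ^ 2 + 24 := by
      have := mul_le_mul_of_nonneg_right e5 hδp.le
      rw [add_mul _ (24 / δ ^ 2), div_mul_cancel₀ _ hδp.ne'] at this
      exact this
    have e7 : (B + (L + 1) / 2) * δ ^ 2 ≤ (B + (L + 1) / 2) :=
      mul_le_of_le_one_right (by linarith) hδ2
    linarith
  -- step 2
  set k := √κ with hk
  have hk0 : 0 < k := Real.sqrt_pos.mpr hκ
  have hkk : k ^ 2 = κ := Real.sq_sqrt hκ.le
  have hk1 : k ≤ 1 := by rw [hk, Real.sqrt_le_one]; exact hκ1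
  have hsk : (√k) ^ 2 = k := Real.sq_sqrt hk0.le
  have hr2 : (δ * √k) ^ 2 = δ ^ 2 * k := by rw [mul_pow, hsk]
  have hr0 : 0 < δ * √k := mul_pos hδ (Real.sqrt_pos.mpr hk0)
  have hr1 : δ * √k ≤ 1 := by
    have : √k ≤ 1 := by rw [Real.sqrt_le_one]; exact hk1
    exact mul_le_one₀ hδ1 (Real.sqrt_nonneg _) this
  have i1 := h1 _ hr0 hr1
  have i2 := h2 _ hr0 hr1
  rw [hr2] at i1 i2
  generalize u (δ * √k) = y at i1 i2
  have j1 : δ ^ 2 * |y - u0| ≤ A * (A + L) * k := by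
    have : δ ^ 2 * |y - u0| ≤ δ ^ 2 * (a * (a + lam) * (δ ^ 2 * k) / 12) := by gcongr
    refine this.trans ?_
    have e : δ ^ 2 * (a * (a + lam) * (δ ^ 2 * k) / 12)
        = (a * δ ^ 2) * (a * δ ^ 2 + lam * δ ^ 2) * k / 12 := by ring
    rw [e]
    have hA0 : 0 ≤ A := by linarith
    have : lam * δ ^ 2 ≤ L := by nlinarith
    have : (a * δ ^ 2) * (a * δ ^ 2 + lam * δ ^ 2) * k ≤ A * (A + L) * k := by gcongr
    have : 0 ≤ A * (A + L) * k := by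
      have : 0 ≤ A + L := by linarith
      positivity
    linarith
  have j2 : δ ^ 2 * |y + 24 * δ ^ 2 / (δ ^ 2 + δ ^ 2 * k) ^ 2| ≤ B * δ ^ 2 + k := by
    have : δ ^ 2 * |y + 24 * δ ^ 2 / (δ ^ 2 + δ ^ 2 * k) ^ 2|
      ≤ δ ^ 2 * (B + κ / (2 * (δ ^ 2 * k))) := by gcongr
    refine this.trans ?_
    have e : δ ^ 2 * (B + κ / (2 * (δ ^ 2 * k))) = B * δ ^ 2 + k / 2 := by
      rw [← hkk]; field_simp
    rw [e]; linarith
  have j3 : δ ^ 2 * (24 * δ ^ 2 / (δ ^ 2 + δ ^ 2 * k) ^ 2) = 24 / (1 + k) ^ 2 := by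
    field_simp
  have j4 : |24 - 24 / (1 + k) ^ 2| ≤ 48 * k := by
    have hh : 24 / (1 + k) ^ 2 ≤ 24 := by
      rw [div_le_iff₀ (by positivity)]; nlinarith
    rw [abs_of_nonneg (by linarith)]
    have : 24 - 48 * k ≤ 24 / (1 + k) ^ 2 := by
      rw [le_div_iff₀ (by positivity)]
      nlinarith [pow_pos hk0 3, pow_pos hk0 2]
    linarith
  have e : δ ^ 2 * u0 + 24 = -(δ ^ 2 * (y - u0)) + δ ^ 2 * (y + 24 * δ ^ 2 / (δ ^ 2 + δ ^ 2 * k) ^ 2)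
      + (24 - 24 / (1 + k) ^ 2) := by
    rw [← j3]; ring
  rw [e]
  refine (abs_add_three _ _ _).trans ?_
  rw [abs_neg, abs_mul, abs_mul, abs_of_pos hδp]
  linarith

theorem statement18 (m : ℕ) (hm : 2 ≤ m)
    (lamBar : ℝ) (w w' w'' : ℝ → ℝ) (hw : OverdetSol lamBar m w w' w'')
    (hnd : Nondeg lamBar w)
    (v₀ v₀' v₀'' : ℝ → ℝ)
    (hv₀d1 : ∀ r ∈ Set.Icc (0:ℝ) 1, HasDerivWithinAt v₀ (v₀' r) (Set.Icc (0:ℝ) 1) r)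
    (hv₀d2 : ∀ r ∈ Set.Icc (0:ℝ) 1, HasDerivWithinAt v₀' (v₀'' r) (Set.Icc (0:ℝ) 1) r)
    (hv₀ode : ∀ r ∈ Set.Ioo (0:ℝ) 1,
      v₀'' r + (5 / r) * v₀' r + (2 * |w r| + lamBar) * v₀ r + w r = 0)
    (hv₀bc0 : v₀' 0 = 0) (hv₀bc1 : v₀ 1 = 0)
    -- assume 1 - 2v̄₀(0) ≠ 0, where v̄₀ = -v₀
    (hnz : 1 - 2 * (-(v₀ 0)) ≠ 0)
    -- the family of solutions constructed by the Ljapunov–Schmidt procedure,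
    -- sampled along an arbitrary sequence of admissible parameters ε n → 0
    (ε : ℕ → ℝ) (hεne : ∀ n, ε n ≠ 0) (hε0 : Tendsto ε atTop (𝓝 0))
    (hsign : ∀ n, (0 < ε n ↔ 0 < 1 - 2 * (-(v₀ 0))))
    (δ : ℕ → ℝ)
    (hδ : Tendsto (fun n => δ n / |ε n|) atTop
      (𝓝 (8 * Real.sqrt 3 / 11 * |1 - 2 * (-(v₀ 0))| / lamBar ^ ((3:ℝ)/2))))
    (φ φd : ℕ → ℝ → ℝ)
    (hφd : ∀ n, ∀ ρ ∈ Set.Icc (0:ℝ) 1, HasDerivWithinAt (φ n) (φd n ρ) (Set.Icc (0:ℝ) 1) ρ)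
    (C : ℝ)
    (hφ : ∀ n, Real.sqrt (π ^ 3 * ∫ ρ in (0:ℝ)..1, ρ ^ 5 * (φd n ρ) ^ 2)
      ≤ C * (ε n) ^ 2 * (abs (Real.log |ε n|)) ^ ((2:ℝ)/3))
    (u : ℕ → ℝ → ℝ)
    (hu : ∀ n ρ, u n ρ = -(w ρ) - ε n * v₀ ρ - PUrad (δ n) ρ + φ n ρ)
    (u' u'' : ℕ → ℝ → ℝ)
    (hsol : ∀ n, BN6NodalSol (lamBar + ε n) m (u n) (u' n) (u'' n)) :
    -- ‖u_ε‖_∞ = -u_ε(0)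
    (∀ᶠ n in atTop, sSup ((fun ρ => |u n ρ|) '' Set.Icc (0:ℝ) 1) = -(u n 0)) ∧
    -- ε² ‖u_ε‖_∞ → (121/8) λ̄³ / (1 - 2v̄₀(0))²
    Tendsto (fun n => (ε n) ^ 2 * sSup ((fun ρ => |u n ρ|) '' Set.Icc (0:ℝ) 1)) atTop
      (𝓝 (121 / 8 * lamBar ^ 3 / (1 - 2 * (-(v₀ 0))) ^ 2)) := by
  set D := 8 * Real.sqrt 3 / 11 * |1 - 2 * (-(v₀ 0))| / lamBar ^ ((3:ℝ)/2) with hD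
  have hlam := hw.lam_pos
  have hDpos : 0 < D := by
    have : 0 < |1 - 2 * (-(v₀ 0))| := abs_pos.mpr hnz
    positivity
  have habs0 : Tendsto (fun n => |ε n|) atTop (𝓝 0) := by simpa using hε0.abs
  have hδ0 : Tendsto δ atTop (𝓝 0) := by
    have := hδ.mul habs0
    rw [mul_zero] at this
    refine this.congr fun n => ?_
    exact div_mul_cancel₀ _ (abs_ne_zero.mpr (hεne n))
  have hδpos : ∀ᶠ n in atTop, 0 < δ n := by
    filter_upwards [hδ.eventually (lt_mem_nhds hDpos)] with n hn
    exact (div_pos_iff_of_pos_right (abs_pos.mpr (hεne n))).mp hn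
  -- the size of φ
  set τ : ℕ → ℝ := fun n => C * (ε n) ^ 2 * (abs (Real.log |ε n|)) ^ ((2:ℝ)/3) with hτ
  have hτ0 : Tendsto τ atTop (𝓝 0) := by
    have hlog : Tendsto (fun x : ℝ => Real.log x * x) (𝓝[>] 0) (𝓝 0) := by
      have := tendsto_log_mul_rpow_nhdsGT_zero (r := 1) one_pos
      simpa using this
    have hne : Tendsto (fun n => |ε n|) atTop (𝓝[>] 0) :=
      tendsto_nhdsWithin_iff.mpr ⟨habs0, Eventually.of_forall fun n => abs_pos.mpr (hεne n)⟩
    have h1 : Tendsto (fun n => |Real.log |ε n| * (|ε n|)|) atTop (𝓝 0) := by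
      simpa using (hlog.comp hne).abs
    have h2 : Tendsto (fun n => |Real.log |ε n| * (|ε n|)| ^ ((2:ℝ)/3)) atTop (𝓝 0) := by
      have := h1.rpow_const (p := (2:ℝ)/3) (Or.inr (by norm_num))
      rwa [Real.zero_rpow (by norm_num)] at this
    have h3 : Tendsto (fun n => |ε n| ^ ((4:ℝ)/3)) atTop (𝓝 0) := by
      have := habs0.rpow_const (p := (4:ℝ)/3) (Or.inr (by norm_num))
      rwa [Real.zero_rpow (by norm_num)] at this
    have h4 := (h3.mul h2).const_mul C
    rw [mul_zero, mul_zero] at h4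
    refine h4.congr fun n => ?_
    have hp : 0 < |ε n| := abs_pos.mpr (hεne n)
    rw [hτ]
    simp only
    rw [abs_mul, abs_abs, Real.mul_rpow (abs_nonneg _) hp.le, ← sq_abs (ε n), mul_assoc C]
    have : |ε n| ^ 2 = |ε n| ^ ((4:ℝ)/3) * |ε n| ^ ((2:ℝ)/3) := by
      rw [← Real.rpow_add hp, ← Real.rpow_natCast]; norm_num
    rw [this]; ring
  set κ : ℕ → ℝ := fun n => τ n + |ε n| with hκ
  have hκ0 : Tendsto κ atTop (𝓝 0) := by simpa using hτ0.add habs0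
  have hτnn : ∀ n, 0 ≤ τ n := fun n => (Real.sqrt_nonneg _).trans (hφ n)
  have hκpos : ∀ n, 0 < κ n := fun n => add_pos_of_nonneg_of_pos (hτnn n) (abs_pos.mpr (hεne n))
  -- bounds for w, v₀
  have cw : ContinuousOn w (Icc 0 1) := fun r hr => (hw.deriv_fst r hr).continuousWithinAt
  have cw' : ContinuousOn w' (Icc 0 1) := fun r hr => (hw.deriv_snd r hr).continuousWithinAt
  have cv : ContinuousOn v₀ (Icc 0 1) := fun r hr => (hv₀d1 r hr).continuousWithinAt
  have cv' : ContinuousOn v₀' (Icc 0 1) := fun r hr => (hv₀d2 r hr).continuousWithinAt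
  obtain ⟨B1, hB1⟩ := isCompact_Icc.exists_bound_of_continuousOn cw
  obtain ⟨B2, hB2⟩ := isCompact_Icc.exists_bound_of_continuousOn cv
  have hB1n : 0 ≤ B1 := (norm_nonneg _).trans (hB1 0 (by simp))
  have hB2n : 0 ≤ B2 := (norm_nonneg _).trans (hB2 0 (by simp))
  set B := B1 + B2 + 24 with hB
  have hBn : 0 ≤ B := by positivity
  have evε : ∀ᶠ n in atTop, |ε n| < min 1 lamBar :=
    habs0.eventually (gt_mem_nhds (lt_min one_pos hlam))
  have hlampos : ∀ᶠ n in atTop, 0 < lamBar + ε n := by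
    filter_upwards [evε] with n hn
    have := (abs_lt.mp (hn.trans_le (min_le_right _ _))).1
    linarith
  -- the pointwise estimate of φ
  have hφb : ∀ n, 0 < δ n → ∀ r, 0 < r → r ≤ 1 → |φ n r| ≤ κ n / (2 * r ^ 2) := by
    intro n hδn r hr0 hr1
    have hs := hsol n
    have cu' : ContinuousOn (u' n) (Icc 0 1) := fun r hr => (hs.deriv_snd r hr).continuousWithinAt
    have hder : ∀ r ∈ Icc (0:ℝ) 1, φd n r = u' n r + w' r + ε n * v₀' r
        + (-(96 * δ n ^ 2 * r / (δ n ^ 2 + r ^ 2) ^ 3)) := by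
      intro r hr
      have h1 := (((hs.deriv_fst r hr).add (hw.deriv_fst r hr)).add
        ((hv₀d1 r hr).const_mul (ε n))).add (aux_PU_deriv hδn r).hasDerivWithinAt
      have h2 : HasDerivWithinAt (φ n) (u' n r + w' r + ε n * v₀' r
        + (-(96 * δ n ^ 2 * r / (δ n ^ 2 + r ^ 2) ^ 3))) (Icc 0 1) r := by
        refine h1.congr_of_mem (fun x _ => ?_) hr
        simp only [Pi.add_apply]
        rw [hu n x]; ring
      exact (uniqueDiffOn_Icc one_pos r hr).eq_deriv _ (hφd n r hr) h2
    have cφd : ContinuousOn (φd n) (Icc 0 1) := by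
      refine ContinuousOn.congr ?_ hder
      have : ContinuousOn (fun r : ℝ => 96 * δ n ^ 2 * r / (δ n ^ 2 + r ^ 2) ^ 3) (Icc 0 1) := by
        apply ContinuousOn.div (by fun_prop) (by fun_prop)
        intro x _; positivity
      fun_prop
    have hφ1 : φ n 1 = 0 := by
      have := hu n 1
      rw [hs.bc_one, hw.bc_one, hv₀bc1] at this
      simp [PUrad] at this
      exact this.symm
    refine aux_radial (hφd n) cφd hφ1 (hκpos n) ?_ hr0 hr1
    set I := ∫ ρ in (0:ℝ)..1, ρ ^ 5 * (φd n ρ) ^ 2 with hI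
    have hI0 : 0 ≤ I := by
      apply integral_nonneg zero_le_one
      intro x hx
      have := hx.1
      positivity
    have hp : 1 ≤ π ^ 3 := one_le_pow₀ (by linarith [Real.pi_gt_three])
    have h1 : π ^ 3 * I ≤ τ n ^ 2 := by
      have := hφ n
      exact (Real.sqrt_le_left (hτnn n)).mp this
    have h2 : τ n ^ 2 ≤ κ n ^ 2 := by
      have := hτnn n
      have h3 : τ n ≤ κ n := by simp only [hκ]; linarith [abs_nonneg (ε n)]
      gcongr
    nlinarith
  have main_est : ∀ᶠ n in atTop, |δ n ^ 2 * u n 0 + 24| ≤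
      (3 * (24 + B + 2 * lamBar + 1)) * (3 * (24 + B + 2 * lamBar + 1) + 2 * lamBar) * √(κ n)
      + B * δ n ^ 2 + 49 * √(κ n) := by
    filter_upwards [hδpos, hδ0.eventually (gt_mem_nhds one_pos), evε, hlampos,
      hκ0.eventually (gt_mem_nhds one_pos)] with n hδn hδ1 hεn hln hκ1
    have hε1 : |ε n| ≤ 1 := (hεn.trans_le (min_le_left _ _)).le
    have hε2 : ε n ≤ lamBar := (le_abs_self _).trans (hεn.trans_le (min_le_right _ _)).le
    refine aux_final (u := u n) (lam := lamBar + ε n) hδn hδ1.le (hκpos n) hκ1.le rfl hln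
      (by linarith) hBn ?_ ?_
    · intro r h0 h1
      exact aux_taylor hln (hsol n) ⟨h0.le, h1⟩
    · intro r h0 h1
      have e : u n r + 24 * δ n ^ 2 / (δ n ^ 2 + r ^ 2) ^ 2 =
          (-(w r) + -(ε n * v₀ r) + 24 * δ n ^ 2 / (δ n ^ 2 + 1) ^ 2) + φ n r := by
        rw [hu n r, PUrad]; ring
      rw [e]
      have x0 := abs_add_le (-(w r) + -(ε n * v₀ r) + 24 * δ n ^ 2 / (δ n ^ 2 + 1) ^ 2) (φ n r)
      have x1 := abs_add_three (-(w r)) (-(ε n * v₀ r)) (24 * δ n ^ 2 / (δ n ^ 2 + 1) ^ 2)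
      rw [abs_neg, abs_neg, abs_mul] at x1
      have y1 : |w r| ≤ B1 := hB1 r ⟨h0.le, h1⟩
      have y2 : |v₀ r| ≤ B2 := hB2 r ⟨h0.le, h1⟩
      have y3 : |ε n| * |v₀ r| ≤ B2 :=
        (mul_le_of_le_one_left (abs_nonneg _) hε1).trans y2
      have y4 : |24 * δ n ^ 2 / (δ n ^ 2 + 1) ^ 2| ≤ 24 := by
        rw [abs_of_nonneg (by positivity), div_le_iff₀ (by positivity)]
        nlinarith [sq_nonneg (δ n), sq_nonneg (δ n ^ 2)]
      have y5 := hφb n hδn r h0 h1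
      linarith
  have hlim : Tendsto (fun n => δ n ^ 2 * u n 0) atTop (𝓝 (-24)) := by
    have hsq : Tendsto (fun n => √(κ n)) atTop (𝓝 0) := by simpa using hκ0.sqrt
    have hz : Tendsto (fun n => (3 * (24 + B + 2 * lamBar + 1)) *
      (3 * (24 + B + 2 * lamBar + 1) + 2 * lamBar) * √(κ n)
      + B * δ n ^ 2 + 49 * √(κ n)) atTop (𝓝 0) := by
      have := ((hsq.const_mul ((3 * (24 + B + 2 * lamBar + 1)) *
        (3 * (24 + B + 2 * lamBar + 1) + 2 * lamBar))).add ((hδ0.pow 2).const_mul B)).add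
        (hsq.const_mul 49)
      simpa using this
    have h0 : Tendsto (fun n => δ n ^ 2 * u n 0 + 24) atTop (𝓝 0) :=
      squeeze_zero_norm' main_est hz
    have := h0.sub_const 24
    simpa using this
  have hsup : ∀ᶠ n in atTop, sSup ((fun ρ => |u n ρ|) '' Set.Icc (0:ℝ) 1) = -(u n 0) := by
    filter_upwards [hlampos, hlim.eventually (gt_mem_nhds (show (-24:ℝ) < 0 by norm_num))]
      with n hln hn
    have hneg : u n 0 < 0 := by
      by_contra hc
      push Not at hc
      have : 0 ≤ δ n ^ 2 * u n 0 := by positivity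
      linarith
    rw [← abs_of_neg hneg]
    apply IsGreatest.csSup_eq
    refine ⟨⟨0, by simp, rfl⟩, ?_⟩
    rintro _ ⟨r, hr, rfl⟩
    exact aux_max hln (hsol n) hr
  refine ⟨hsup, ?_⟩
  have hfin : Tendsto (fun n => -(δ n ^ 2 * u n 0) / (δ n / |ε n|) ^ 2) atTop
      (𝓝 (-(-24) / D ^ 2)) := hlim.neg.div (hδ.pow 2) (by positivity)
  have hval : -(-24) / D ^ 2 = 121 / 8 * lamBar ^ 3 / (1 - 2 * (-(v₀ 0))) ^ 2 := by
    have hl3 : (lamBar ^ ((3:ℝ)/2)) ^ 2 = lamBar ^ 3 := by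
      rw [← Real.rpow_natCast, ← Real.rpow_mul hlam.le, ← Real.rpow_natCast]; norm_num
    have h3 : √(3:ℝ) ^ 2 = 3 := Real.sq_sqrt (by norm_num)
    rw [hD, div_pow, mul_pow, div_pow, mul_pow, sq_abs, hl3, h3]
    field_simp
    norm_num
  rw [← hval]
  refine hfin.congr' ?_
  filter_upwards [hsup, hδpos] with n hn hδn
  rw [hn, div_pow, sq_abs]
  have := hεne n
  field_simp
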